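/- arXiv:1708.01861 — 2 statements merged into one kernel-verified Lean document; each statement's English description precedes it below -/
import Mathlib

section
/- (Affine invariance of the capacity.) Fix integers m ≥ 1, n ≥ 1, an invertible matrix A ∈ ℝ^{m×m}, a vector b ∈ ℝ^m, and a measurable function g : (ℝ^m)^n → [0,∞] of the form g(x^n) = sup_{μ∈ℝ^m, Σ≻0} f(x^n;μ,Σ)·π(μ,Σ;ν,σ²,ρ²) with ν > m−1, σ², ρ² > 0. If each observation is transformed by the bijective affine map y_i = A⁻¹x_i + b and g' denotes the supremum of the correspondingly transformed likelihood-times-luckiness functions (each multiplied by the Jacobian factor |A| per observation, so that probability densities transform as densities), then ∫_{(ℝ^m)^n} g'(y^n) dy^n = ∫_{(ℝ^m)^n} g(x^n) dx^n; i.e., the capacity is invariant under bijective affine reparametrization of the data. -/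
open MeasureTheory Matrix Real BigOperators

/-- Likelihood of `n` observations under the `m`-dimensional normal distribution
with mean `μ` and covariance `S`. -/
noncomputable def mvnLik (m n : ℕ) (x : Fin n → Fin m → ℝ) (μ : Fin m → ℝ)
    (S : Matrix (Fin m) (Fin m) ℝ) : ℝ :=
  ∏ i : Fin n, (2 * π) ^ (-(m : ℝ) / 2) * S.det ^ (-(1 : ℝ) / 2) *
    Real.exp (-(1 / 2) * ((x i - μ) ⬝ᵥ (S⁻¹ *ᵥ (x i - μ))))

/-- The simple luckiness function `π(μ, Σ; ν, σ², ρ²)`. -/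
noncomputable def luck (m : ℕ) (μ : Fin m → ℝ) (S : Matrix (Fin m) (Fin m) ℝ)
    (ν σ2 ρ2 : ℝ) : ℝ :=
  (2 * π) ^ (-(m : ℝ) * ν / 2) * S.det ^ (-ν / 2) *
    Real.exp (-(ν / 2) *
      (S⁻¹ * (σ2 • (1 : Matrix (Fin m) (Fin m) ℝ) + ρ2 • vecMulVec μ μ)).trace)

/-- The generalized luckiness function `π(μ, Σ; ν, μ₀, Σ₀, ρ²)`. -/
noncomputable def luck2 (m : ℕ) (μ : Fin m → ℝ) (S : Matrix (Fin m) (Fin m) ℝ)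
    (ν : ℝ) (μ0 : Fin m → ℝ) (S0 : Matrix (Fin m) (Fin m) ℝ) (ρ2 : ℝ) : ℝ :=
  (2 * π) ^ (-(m : ℝ) * ν / 2) * S.det ^ (-ν / 2) *
    Real.exp (-(ν / 2) *
      (S⁻¹ * (S0 + ρ2 • vecMulVec (μ - μ0) (μ - μ0))).trace)

/-- MAP location estimate `μ̄_k` for the simple luckiness. -/
noncomputable def muBar (m k : ℕ) (ν ρ2 : ℝ) (x : Fin k → Fin m → ℝ) : Fin m → ℝ :=
  (1 / (k + ρ2 * ν)) • ∑ i : Fin k, x i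

/-- MAP covariance estimate `Σ̄_k` for the simple luckiness. -/
noncomputable def sigmaBar (m k : ℕ) (ν σ2 ρ2 : ℝ) (x : Fin k → Fin m → ℝ) :
    Matrix (Fin m) (Fin m) ℝ :=
  (1 / (k + ν)) •
      (∑ i : Fin k, vecMulVec (x i) (x i) + (ν * σ2) • (1 : Matrix (Fin m) (Fin m) ℝ))
    - (1 / ((ν + k) * (ρ2 * ν + k))) • ∑ i : Fin k, ∑ j : Fin k, vecMulVec (x i) (x j)

/-- MAP location estimate `μ̄_k` for the generalized luckiness. -/
noncomputable def muBar2 (m k : ℕ) (ν ρ2 : ℝ) (μ0 : Fin m → ℝ)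
    (x : Fin k → Fin m → ℝ) : Fin m → ℝ :=
  μ0 + (1 / (k + ρ2 * ν)) • ∑ i : Fin k, (x i - μ0)

/-- MAP covariance estimate `Σ̄_k` for the generalized luckiness. -/
noncomputable def sigmaBar2 (m k : ℕ) (ν ρ2 : ℝ) (μ0 : Fin m → ℝ)
    (S0 : Matrix (Fin m) (Fin m) ℝ) (x : Fin k → Fin m → ℝ) : Matrix (Fin m) (Fin m) ℝ :=
  (1 / (k + ν)) • (∑ i : Fin k, vecMulVec (x i - μ0) (x i - μ0) + ν • S0)
    - (1 / ((ν + k) * (ρ2 * ν + k))) •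
        ∑ i : Fin k, ∑ j : Fin k, vecMulVec (x i - μ0) (x j - μ0)

/-- The multivariate gamma function `Γ_m(z)`. -/
noncomputable def multiGamma (m : ℕ) (z : ℝ) : ℝ :=
  π ^ ((m : ℝ) * ((m : ℝ) - 1) / 4) * ∏ j : Fin m, Real.Gamma (z - (j : ℝ) / 2)

/-- The capacity `𝒞(m, n, ν, σ², ρ²)` (note: the fourth argument is `σ²`,
so `σ^{-mν} = (σ²)^{-mν/2}`). -/
noncomputable def capC (m n : ℕ) (ν σ2 ρ2 : ℝ) : ℝ :=
  σ2 ^ (-(m : ℝ) * ν / 2) *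
    ((((n : ℝ) + ν) ^ ((n : ℝ) + ν) * (1 + n / (ρ2 * ν))) /
        ((2 * Real.exp 1) ^ ((n : ℝ) + ν) * (π * ν) ^ ν)) ^ ((m : ℝ) / 2) *
    (multiGamma m (ν / 2) / multiGamma m (((n : ℝ) + ν) / 2))

/-- The pointwise supremum of likelihood times simple luckiness over all `μ`
and positive definite `Σ`. -/
noncomputable def supLik (m n : ℕ) (ν σ2 ρ2 : ℝ) (x : Fin n → Fin m → ℝ) : ℝ :=
  ⨆ p : (Fin m → ℝ) × {S : Matrix (Fin m) (Fin m) ℝ // S.PosDef},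
    mvnLik m n x p.1 p.2.1 * luck m p.1 p.2.1 ν σ2 ρ2

/-- The pointwise supremum of likelihood times generalized luckiness over all `μ`
and positive definite `Σ`. -/
noncomputable def supLik2 (m n : ℕ) (ν : ℝ) (μ0 : Fin m → ℝ)
    (S0 : Matrix (Fin m) (Fin m) ℝ) (ρ2 : ℝ) (x : Fin n → Fin m → ℝ) : ℝ :=
  ⨆ p : (Fin m → ℝ) × {S : Matrix (Fin m) (Fin m) ℝ // S.PosDef},
    mvnLik m n x p.1 p.2.1 * luck2 m p.1 p.2.1 ν μ0 S0 ρ2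

/-- The density of the `m`-variate Student t-distribution with `d` degrees of
freedom, location `μ` and scale matrix `S`. -/
noncomputable def tDens (m : ℕ) (d : ℝ) (x μ : Fin m → ℝ)
    (S : Matrix (Fin m) (Fin m) ℝ) : ℝ :=
  Real.Gamma ((d + m) / 2) /
      (Real.Gamma (d / 2) * (d * π) ^ ((m : ℝ) / 2) * S.det ^ ((1 : ℝ) / 2)) *
    (1 + (1 / d) * ((x - μ) ⬝ᵥ (S⁻¹ *ᵥ (x - μ)))) ^ (-(d + (m : ℝ)) / 2)

/-- Change of variables under applying one invertible matrix to each of `n` vectors. -/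
theorem integral_comp_mulVec_pi {m n : ℕ} {E : Type*} [NormedAddCommGroup E] [NormedSpace ℝ E]
    {A : Matrix (Fin m) (Fin m) ℝ} (hA : A.det ≠ 0) (g : (Fin n → Fin m → ℝ) → E) :
    ∫ y : Fin n → Fin m → ℝ, |A.det| ^ n • g (fun i => A *ᵥ y i) = ∫ x, g x := by
  let L : (Fin n → Fin m → ℝ) →ₗ[ℝ] Fin n → Fin m → ℝ :=
    LinearMap.pi fun i => (Matrix.toLin' A).comp (LinearMap.proj i)
  have hL : LinearMap.det L = A.det ^ n := by
    simp [L, LinearMap.det_pi]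
  have hdet : LinearMap.det L ≠ 0 := hL ▸ pow_ne_zero n hA
  have hemb : MeasurableEmbedding L :=
    (L.equivOfDetNeZero hdet).toContinuousLinearEquiv.toHomeomorph.measurableEmbedding
  have hmap := hemb.integral_map (μ := volume) g
  rw [Measure.map_linearMap_addHaar_eq_smul_addHaar volume hdet, integral_smul_measure,
    ENNReal.toReal_ofReal (abs_nonneg _), hL, abs_inv, abs_pow] at hmap
  rw [integral_smul]
  change |A.det| ^ n • ∫ y, g (L y) = _
  rw [← hmap, smul_inv_smul₀ (pow_ne_zero n (abs_ne_zero.mpr hA))]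

/-- affine invariance of the capacity.  Transforming each
observation by the bijective affine map `y_i = A⁻¹ x_i + b` (so `x_i = A (y_i - b)`,
and densities pick up the Jacobian factor `|A|` per observation) leaves the
capacity unchanged. -/
theorem capacity_affine_invariant (m n : ℕ) (hm : 1 ≤ m) (hn : 1 ≤ n) (ν σ2 ρ2 : ℝ)
    (hν : (m : ℝ) - 1 < ν) (hσ : 0 < σ2) (hρ : 0 < ρ2)
    (A : Matrix (Fin m) (Fin m) ℝ) (hA : IsUnit A.det) (b : Fin m → ℝ) :
    ∫ y : Fin n → Fin m → ℝ,
        |A.det| ^ n * supLik m n ν σ2 ρ2 (fun i => A *ᵥ (y i - b))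
      = ∫ x : Fin n → Fin m → ℝ, supLik m n ν σ2 ρ2 x := by
  rw [← integral_comp_mulVec_pi hA.ne_zero (supLik m n ν σ2 ρ2)]
  exact integral_sub_right_eq_self
    (fun y : Fin n → Fin m → ℝ => |A.det| ^ n • supLik m n ν σ2 ρ2 (fun i => A *ᵥ y i))
    (fun _ => b)
end

section
/- (Theorem 2, capacity.) Fix integers m ≥ 1, n ≥ 1, reals ν > m−1, ρ² > 0, a vector μ₀ ∈ ℝ^m and a positive definite matrix Σ₀ ∈ ℝ^{m×m}. Then ∫_{(ℝ^m)^n} sup_{μ∈ℝ^m, Σ≻0} f(x^n;μ,Σ)·π(μ,Σ;ν,μ₀,Σ₀,ρ²) dx^n = 𝒞(m,n,ν,|Σ₀|^{1/m},ρ²), where 𝒞(m,n,ν,σ²,ρ²) = σ^{−mν}·((n+ν)^{n+ν}·(1+n/(ρ²ν)) / ((2e)^{n+ν}·(πν)^ν))^{m/2} · Γ_m(ν/2)/Γ_m((n+ν)/2). -/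
open MeasureTheory Matrix Real BigOperators

theorem Matrix.PosDef.exists_transpose_mul_self {m : ℕ} {P : Matrix (Fin m) (Fin m) ℝ}
    (hP : P.PosDef) : ∃ C : Matrix (Fin m) (Fin m) ℝ, C.det ≠ 0 ∧ P = Cᵀ * C := by
  open scoped MatrixOrder ComplexOrder Matrix.Norms.L2Operator in
  obtain ⟨C, hC, h⟩ := CStarAlgebra.isStrictlyPositive_iff_eq_star_mul_self.mp
    hP.isStrictlyPositive
  refine ⟨C, ?_, ?_⟩
  · have := hC
    rw [Matrix.isUnit_iff_isUnit_det] at this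
    exact this.ne_zero
  · simpa [Matrix.star_eq_conjTranspose] using h

theorem vecMulVec_self_posSemidef {m : ℕ} (v : Fin m → ℝ) : (vecMulVec v v).PosSemidef := by
  simpa using Matrix.posSemidef_vecMulVec_self_star v

theorem det_add_vecMulVec {m : ℕ} {A : Matrix (Fin m) (Fin m) ℝ} (hA : IsUnit A.det)
    (u v : Fin m → ℝ) : (A + vecMulVec u v).det = A.det * (1 + v ⬝ᵥ (A⁻¹ *ᵥ u)) := by
  have h := Matrix.det_add_replicateCol_mul_replicateRow (ι := Unit) hA u v
  rw [← vecMulVec_eq] at h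
  rw [h]
  congr 1
  rw [det_unique, Matrix.mul_assoc, Matrix.add_apply, one_apply_eq]
  simp [Matrix.mul_apply, dotProduct, mulVec]

theorem Matrix.PosDef.det_le_exp_trace_sub {m : ℕ} {T : Matrix (Fin m) (Fin m) ℝ}
    (hT : T.PosDef) : T.det ≤ exp (T.trace - m) := by
  rw [hT.1.det_eq_prod_eigenvalues, hT.1.trace_eq_sum_eigenvalues]
  have : (m : ℝ) = ∑ _i : Fin m, (1 : ℝ) := by simp
  rw [this, ← Finset.sum_sub_distrib, exp_sum]
  refine Finset.prod_le_prod (fun i _ => (hT.eigenvalues_pos i).le) fun i _ => ?_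
  have := add_one_le_exp (hT.1.eigenvalues i - 1)
  simpa using this

theorem Matrix.PosDef.det_inv_mul_le_exp_trace_sub {m : ℕ} {S A : Matrix (Fin m) (Fin m) ℝ}
    (hS : S.PosDef) (hA : A.PosDef) : S.det⁻¹ * A.det ≤ exp ((S⁻¹ * A).trace - m) := by
  obtain ⟨C, hC, h⟩ := hS.inv.exists_transpose_mul_self
  have hT : (C * A * Cᵀ).PosDef := by
    have hU : IsUnit C := (Matrix.isUnit_iff_isUnit_det C).2 hC.isUnit
    simpa [Matrix.star_eq_conjTranspose] using hU.posDef_star_right_conjugate_iff.2 hA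
  have h1 : (C * A * Cᵀ).trace = (S⁻¹ * A).trace := by
    rw [h, Matrix.trace_mul_comm, Matrix.mul_assoc]
  have h2 : (C * A * Cᵀ).det = S.det⁻¹ * A.det := by
    have : S.det⁻¹ = (S⁻¹).det := by simp [Matrix.det_nonsing_inv]
    rw [this, h]
    simp only [Matrix.det_mul, Matrix.det_transpose]
    ring
  rw [← h1, ← h2]
  exact hT.det_le_exp_trace_sub

/-- The matrix `M + ∑ᵢ xᵢ xᵢᵀ - (n + r)⁻¹ (∑ᵢ xᵢ) (∑ᵢ xᵢ)ᵀ`. -/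
noncomputable def scatter {m : ℕ} (n : ℕ) (r : ℝ) (M : Matrix (Fin m) (Fin m) ℝ)
    (x : Fin n → Fin m → ℝ) : Matrix (Fin m) (Fin m) ℝ :=
  M + ∑ i, vecMulVec (x i) (x i) - (n + r)⁻¹ • vecMulVec (∑ i, x i) (∑ i, x i)

theorem scatter_cons {m n : ℕ} {r : ℝ} (hr : 0 < r) (M : Matrix (Fin m) (Fin m) ℝ)
    (y : Fin m → ℝ) (x : Fin n → Fin m → ℝ) :
    scatter (n + 1) r M (Fin.cons y x) = scatter n r M x + ((n + r) / (n + r + 1)) •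
      vecMulVec (y - (n + r)⁻¹ • ∑ i, x i) (y - (n + r)⁻¹ • ∑ i, x i) := by
  have h1 : (n : ℝ) + r ≠ 0 := by positivity
  have h2 : (n : ℝ) + r + 1 ≠ 0 := by positivity
  have h3 : (n : ℝ) + 1 + r ≠ 0 := by positivity
  ext a b
  simp only [scatter, Fin.sum_univ_succ, Fin.cons_zero, Fin.cons_succ, Matrix.add_apply,
    Matrix.sub_apply, Matrix.smul_apply, vecMulVec_apply, Pi.add_apply, Pi.sub_apply,
    Pi.smul_apply, smul_eq_mul, Nat.cast_add, Nat.cast_one]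
  generalize (∑ i, x i) a = s
  generalize (∑ i, x i) b = t
  field_simp
  ring

theorem scatter_posDef {m n : ℕ} {r : ℝ} (hr : 0 < r) {M : Matrix (Fin m) (Fin m) ℝ}
    (hM : M.PosDef) (x : Fin n → Fin m → ℝ) : (scatter n r M x).PosDef := by
  induction n with
  | zero => simpa [scatter] using hM
  | succ n ih =>
    rw [← Fin.cons_self_tail x, scatter_cons hr]
    exact (ih _).add_posSemidef ((vecMulVec_self_posSemidef _).smul (by positivity))

theorem continuous_scatter {m : ℕ} (n : ℕ) (r : ℝ) (M : Matrix (Fin m) (Fin m) ℝ) :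
    Continuous (scatter n r M) := by
  unfold scatter
  refine continuous_matrix fun a b => ?_
  simp only [Matrix.add_apply, Matrix.sub_apply, Matrix.smul_apply, vecMulVec_apply,
    Matrix.sum_apply, Finset.sum_apply]
  fun_prop

theorem multiGamma_add_half_mul (m : ℕ) (z : ℝ) :
    multiGamma m (z + 1 / 2) * Real.Gamma (z + 1 / 2 - m / 2) =
      multiGamma m z * Real.Gamma (z + 1 / 2) := by
  have h1 := Fin.prod_univ_castSucc fun j : Fin (m + 1) => Real.Gamma (z + 1 / 2 - (j : ℝ) / 2)
  have h2 := Fin.prod_univ_succ fun j : Fin (m + 1) => Real.Gamma (z + 1 / 2 - (j : ℝ) / 2)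
  rw [h1] at h2
  simp only [Fin.val_castSucc, Fin.val_last, Fin.val_zero, Fin.val_succ] at h2
  have h3 (j : Fin m) : z + 1 / 2 - ((j + 1 : ℕ) : ℝ) / 2 = z - (j : ℝ) / 2 := by
    push_cast; ring
  simp only [h3] at h2
  unfold multiGamma
  rw [mul_assoc, h2]
  simp
  ring

theorem lintegral_exp_neg_mul_dotProduct (m : ℕ) {u : ℝ} (hu : 0 < u) :
    ∫⁻ x : Fin m → ℝ, ENNReal.ofReal (exp (-(u * (x ⬝ᵥ x)))) =
      ENNReal.ofReal ((π / u) ^ ((m : ℝ) / 2)) := by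
  have h (x : Fin m → ℝ) : exp (-(u * (x ⬝ᵥ x))) = ∏ i, exp (-u * x i ^ 2) := by
    rw [← exp_sum, dotProduct, Finset.mul_sum, ← Finset.sum_neg_distrib]
    congr 1
    exact Finset.sum_congr rfl fun i _ => by ring
  simp only [h]
  rw [← ofReal_integral_eq_lintegral_ofReal, integral_fintype_prod_volume_eq_prod
    (fun _ (t : ℝ) => exp (-u * t ^ 2)), integral_gaussian]
  · rw [Finset.prod_const, Finset.card_univ, Fintype.card_fin, sqrt_eq_rpow,
      ← rpow_mul_natCast (by positivity)]
    congr 2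
    ring
  · exact Integrable.fintype_prod (f := fun _ (t : ℝ) => exp (-u * t ^ 2))
      fun _ => integrable_exp_neg_mul_sq hu
  · exact Filter.Eventually.of_forall fun x => by positivity

theorem lintegral_rpow_mul_exp_neg_mul_Ioi {a r : ℝ} (ha : 0 < a) (hr : 0 < r) :
    ∫⁻ t in Set.Ioi (0 : ℝ), ENNReal.ofReal (t ^ (a - 1) * exp (-(r * t))) =
      ENNReal.ofReal ((1 / r) ^ a * Real.Gamma a) := by
  have h := integral_rpow_mul_exp_neg_mul_Ioi ha hr
  have hpos : 0 < (1 / r) ^ a * Real.Gamma a :=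
    mul_pos (by positivity) (Real.Gamma_pos_of_pos ha)
  rw [← h, ofReal_integral_eq_lintegral_ofReal]
  · exact not_imp_comm.1 integral_undef (by rw [h]; exact hpos.ne')
  · filter_upwards [ae_restrict_mem measurableSet_Ioi] with t ht
    have : (0 : ℝ) < t := ht
    positivity

theorem lintegral_one_add_dotProduct_rpow {m : ℕ} {b : ℝ} (hb : (m : ℝ) / 2 < b) :
    ∫⁻ x : Fin m → ℝ, ENNReal.ofReal ((1 + x ⬝ᵥ x) ^ (-b)) =
      ENNReal.ofReal (π ^ ((m : ℝ) / 2) * Real.Gamma (b - m / 2) / Real.Gamma b) := by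
  have hb0 : 0 < b := lt_of_le_of_lt (by positivity) hb
  have hG : 0 < Real.Gamma b := Real.Gamma_pos_of_pos hb0
  have hnn (x : Fin m → ℝ) : 0 ≤ x ⬝ᵥ x := Finset.sum_nonneg fun i _ => mul_self_nonneg _
  have key (x : Fin m → ℝ) : ENNReal.ofReal ((1 + x ⬝ᵥ x) ^ (-b)) =
      ∫⁻ t in Set.Ioi (0 : ℝ), ENNReal.ofReal (Real.Gamma b)⁻¹ *
        (ENNReal.ofReal (t ^ (b - 1) * exp (-(1 * t))) *
          ENNReal.ofReal (exp (-(t * (x ⬝ᵥ x))))) := by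
    have hx : 0 < 1 + x ⬝ᵥ x := by linarith [hnn x]
    have e (t : ℝ) : ENNReal.ofReal (t ^ (b - 1) * exp (-(1 * t))) *
        ENNReal.ofReal (exp (-(t * (x ⬝ᵥ x)))) =
        ENNReal.ofReal (t ^ (b - 1) * exp (-((1 + x ⬝ᵥ x) * t))) := by
      rw [← ENNReal.ofReal_mul' (by positivity), mul_assoc, ← exp_add]
      congr 3
      ring_nf
    simp only [e]
    rw [lintegral_const_mul _ (by fun_prop), lintegral_rpow_mul_exp_neg_mul_Ioi hb0 hx,
      ← ENNReal.ofReal_mul (by positivity), one_div, inv_rpow hx.le, rpow_neg hx.le]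
    congr 1
    field_simp
  simp only [key]
  rw [lintegral_lintegral_swap]
  · have e : ∀ t ∈ Set.Ioi (0 : ℝ), (∫⁻ x : Fin m → ℝ, ENNReal.ofReal (Real.Gamma b)⁻¹ *
        (ENNReal.ofReal (t ^ (b - 1) * exp (-(1 * t))) *
          ENNReal.ofReal (exp (-(t * (x ⬝ᵥ x)))))) =
        ENNReal.ofReal (π ^ ((m : ℝ) / 2) / Real.Gamma b) *
          ENNReal.ofReal (t ^ ((b - m / 2) - 1) * exp (-(1 * t))) := by
      intro t ht
      have ht : 0 < t := ht
      have hm : Measurable fun x : Fin m → ℝ => ENNReal.ofReal (exp (-(t * (x ⬝ᵥ x)))) := by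
        unfold dotProduct
        fun_prop
      rw [lintegral_const_mul _ (hm.const_mul _), lintegral_const_mul _ hm,
        lintegral_exp_neg_mul_dotProduct m ht,
        ← ENNReal.ofReal_mul (by positivity), ← ENNReal.ofReal_mul (by positivity),
        ← ENNReal.ofReal_mul (by positivity), div_rpow (by positivity) ht.le]
      congr 1
      rw [show b - (m : ℝ) / 2 - 1 = (b - 1) - m / 2 by ring, rpow_sub ht (b - 1)]
      field_simp
    rw [setLIntegral_congr_fun measurableSet_Ioi e, lintegral_const_mul _ (by fun_prop),
      lintegral_rpow_mul_exp_neg_mul_Ioi (by linarith) one_pos,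
      ← ENNReal.ofReal_mul (by positivity)]
    congr 1
    simp
    ring
  · unfold Function.uncurry dotProduct
    apply Measurable.aemeasurable
    fun_prop

theorem lintegral_one_add_quadratic_rpow {m : ℕ} {b : ℝ} (hb : (m : ℝ) / 2 < b)
    {P : Matrix (Fin m) (Fin m) ℝ} (hP : P.PosDef) (v : Fin m → ℝ) :
    ∫⁻ x : Fin m → ℝ, ENNReal.ofReal ((1 + (x - v) ⬝ᵥ (P *ᵥ (x - v))) ^ (-b)) =
      ENNReal.ofReal (P.det ^ (-(1 / 2) : ℝ) *
        (π ^ ((m : ℝ) / 2) * Real.Gamma (b - m / 2) / Real.Gamma b)) := by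
  obtain ⟨C, hC, rfl⟩ := hP.exists_transpose_mul_self
  rw [lintegral_sub_right_eq_self
    (fun x : Fin m → ℝ => ENNReal.ofReal ((1 + x ⬝ᵥ ((Cᵀ * C) *ᵥ x)) ^ (-b)))]
  have hq (x : Fin m → ℝ) : x ⬝ᵥ ((Cᵀ * C) *ᵥ x) = toLin' C x ⬝ᵥ toLin' C x := by
    rw [toLin'_apply, ← mulVec_mulVec, dotProduct_mulVec, vecMul_transpose]
  have hm : Measurable fun x : Fin m → ℝ => ENNReal.ofReal ((1 + x ⬝ᵥ x) ^ (-b)) := by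
    unfold dotProduct
    fun_prop
  have hT : Measurable (toLin' C) := (LinearMap.continuous_of_finiteDimensional _).measurable
  simp only [hq]
  rw [← lintegral_map hm hT, Real.map_matrix_volume_pi_eq_smul_volume_pi hC,
    lintegral_smul_measure, lintegral_one_add_dotProduct_rpow hb, smul_eq_mul,
    ← ENNReal.ofReal_mul (by positivity)]
  congr 2
  rw [det_mul, det_transpose, abs_inv, rpow_neg (mul_self_nonneg _), ← sqrt_eq_rpow,
    sqrt_mul_self_eq_abs]

theorem lintegral_det_scatter_cons {m n : ℕ} {r b : ℝ} (hr : 0 < r) (hb : (m : ℝ) / 2 < b)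
    {M : Matrix (Fin m) (Fin m) ℝ} (hM : M.PosDef) (x : Fin n → Fin m → ℝ) :
    ∫⁻ y : Fin m → ℝ, ENNReal.ofReal ((scatter (n + 1) r M (Fin.cons y x)).det ^ (-b)) =
      ENNReal.ofReal (((n + r + 1) / (n + r)) ^ ((m : ℝ) / 2) *
        (π ^ ((m : ℝ) / 2) * Real.Gamma (b - m / 2) / Real.Gamma b)) *
      ENNReal.ofReal ((scatter n r M x).det ^ (-(b - 1 / 2))) := by
  have hA := scatter_posDef hr hM x
  set A := scatter n r M x
  have hq : 0 < (n : ℝ) + r := by positivity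
  set t : ℝ := (n + r) / (n + r + 1) with ht
  have ht0 : 0 < t := by positivity
  set v := ((n : ℝ) + r)⁻¹ • ∑ i, x i
  have hP : (t • A⁻¹).PosDef := hA.inv.smul ht0
  have e (y : Fin m → ℝ) : ENNReal.ofReal ((scatter (n + 1) r M (Fin.cons y x)).det ^ (-b)) =
      ENNReal.ofReal (A.det ^ (-b)) *
        ENNReal.ofReal ((1 + (y - v) ⬝ᵥ ((t • A⁻¹) *ᵥ (y - v))) ^ (-b)) := by
    have h0 : 0 ≤ (y - v) ⬝ᵥ ((t • A⁻¹) *ᵥ (y - v)) := by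
      simpa using hP.posSemidef.dotProduct_mulVec_nonneg (y - v)
    rw [scatter_cons hr, ← ENNReal.ofReal_mul (rpow_nonneg hA.det_pos.le _),
      ← mul_rpow hA.det_pos.le (by positivity), ← smul_vecMulVec,
      det_add_vecMulVec hA.det_pos.ne'.isUnit, mulVec_smul, smul_mulVec]
  simp only [e]
  have hG : 0 ≤ π ^ ((m : ℝ) / 2) * Real.Gamma (b - m / 2) / Real.Gamma b := by
    have := Real.Gamma_pos_of_pos (s := b - m / 2) (by linarith)
    have := Real.Gamma_pos_of_pos (s := b) (lt_of_le_of_lt (by positivity) hb)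
    positivity
  have hd := hA.det_pos
  rw [lintegral_const_mul, lintegral_one_add_quadratic_rpow hb hP,
    ← ENNReal.ofReal_mul (by positivity), ← ENNReal.ofReal_mul (by positivity), ← mul_assoc,
    mul_right_comm _ _ (A.det ^ _)]
  · congr 2
    have e1 : ((n + r + 1) / (n + r)) = t⁻¹ := by rw [ht, inv_div]
    rw [det_smul, det_nonsing_inv, Ring.inverse_eq_inv', Fintype.card_fin,
      mul_rpow (by positivity) (by positivity), ← rpow_natCast, ← rpow_mul ht0.le,
      inv_rpow hd.le, e1, inv_rpow ht0.le, ← rpow_neg ht0.le, ← rpow_neg hd.le,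
      show -(b - 1 / 2) = -b + -(-(1 / 2)) by ring, rpow_add hd,
      show (m : ℝ) * -(1 / 2) = -(m / 2) by ring]
    ring
  · unfold dotProduct mulVec dotProduct
    fun_prop

theorem multiGamma_pos {m : ℕ} {z : ℝ} (hz : (m : ℝ) - 1 < 2 * z) : 0 < multiGamma m z := by
  refine mul_pos (by positivity) (Finset.prod_pos fun j _ => Real.Gamma_pos_of_pos ?_)
  have : (j : ℝ) + 1 ≤ m := by exact_mod_cast j.2
  linarith

theorem lintegral_det_scatter {m : ℕ} (n : ℕ) {r ν : ℝ} (hr : 0 < r) (hν : (m : ℝ) - 1 < ν)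
    {M : Matrix (Fin m) (Fin m) ℝ} (hM : M.PosDef) :
    ∫⁻ x : Fin n → Fin m → ℝ, ENNReal.ofReal ((scatter n r M x).det ^ (-((n + ν) / 2))) =
      ENNReal.ofReal (((n + r) / r) ^ ((m : ℝ) / 2) * π ^ ((n : ℝ) * m / 2) *
        (multiGamma m (ν / 2) / multiGamma m ((n + ν) / 2)) * M.det ^ (-(ν / 2))) := by
  induction n with
  | zero =>
    have : multiGamma m (ν / 2) ≠ 0 := (multiGamma_pos (by linarith)).ne'
    rw [lintegral_unique, volume_pi, Measure.pi_of_empty]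
    simp [scatter, hr.ne', this]
  | succ n ih =>
    have hb : (m : ℝ) / 2 < ((n + 1 : ℕ) + ν) / 2 := by
      push_cast
      have : (0 : ℝ) ≤ n := n.cast_nonneg
      linarith
    have hmeas : Measurable fun x : Fin (n + 1) → Fin m → ℝ =>
        ENNReal.ofReal ((scatter (n + 1) r M x).det ^ (-(((n + 1 : ℕ) + ν) / 2))) :=
      ((continuous_scatter _ r M).matrix_det.measurable.pow_const _).ennreal_ofReal
    have hmp := (volume_preserving_piFinSuccAbove (fun _ : Fin (n + 1) => Fin m → ℝ) 0).symm
    rw [← hmp.lintegral_comp hmeas, Measure.volume_eq_prod, lintegral_prod_symm _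
      (by exact (hmeas.comp hmp.measurable).aemeasurable)]
    have e (x : Fin n → Fin m → ℝ) (y : Fin m → ℝ) :
        (MeasurableEquiv.piFinSuccAbove (fun _ : Fin (n + 1) => Fin m → ℝ) 0).symm (y, x) =
          Fin.cons y x := by
      simp [MeasurableEquiv.piFinSuccAbove]
      rfl
    simp only [e, lintegral_det_scatter_cons hr hb hM]
    have e2 : ((n + 1 : ℕ) + ν) / 2 - 1 / 2 = (n + ν) / 2 := by push_cast; ring
    have hn0 : (0 : ℝ) ≤ n := n.cast_nonneg
    have hG1 := Real.Gamma_pos_of_pos (s := ((n + 1 : ℕ) + ν) / 2 - m / 2) (by linarith)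
    have hG2 := Real.Gamma_pos_of_pos (s := ((n + 1 : ℕ) + ν) / 2)
      (lt_of_le_of_lt (by positivity) hb)
    have hM1 : 0 < multiGamma m ((n + ν) / 2) := multiGamma_pos (by linarith)
    have hM2 : 0 < multiGamma m (((n + 1 : ℕ) + ν) / 2) :=
      multiGamma_pos (by push_cast; linarith)
    rw [lintegral_const_mul' _ _ ENNReal.ofReal_ne_top, e2, ih,
      ← ENNReal.ofReal_mul (by positivity)]
    congr 1
    have hg := multiGamma_add_half_mul m ((n + ν) / 2)
    rw [show (n + ν) / 2 + 1 / 2 = ((n + 1 : ℕ) + ν) / 2 by push_cast; ring] at hg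
    have hr1 : ((n + 1 : ℕ) + r) / r = ((n + r + 1) / (n + r)) * ((n + r) / r) := by
      push_cast
      field_simp
      ring
    have hp : π ^ (((n + 1 : ℕ) : ℝ) * m / 2) = π ^ ((m : ℝ) / 2) * π ^ ((n : ℝ) * m / 2) := by
      rw [← rpow_add pi_pos]
      congr 1
      push_cast
      ring
    have hratio : Real.Gamma (((n + 1 : ℕ) + ν) / 2 - m / 2) / Real.Gamma (((n + 1 : ℕ) + ν) / 2) =
        multiGamma m ((n + ν) / 2) / multiGamma m (((n + 1 : ℕ) + ν) / 2) := by
      rw [div_eq_div_iff hG2.ne' hM2.ne']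
      linarith
    rw [hr1, mul_rpow (by positivity) (by positivity), hp, mul_div_assoc (π ^ _), hratio]
    field_simp

theorem trace_mul_vecMulVec {m : ℕ} (P : Matrix (Fin m) (Fin m) ℝ) (v : Fin m → ℝ) :
    (P * vecMulVec v v).trace = v ⬝ᵥ (P *ᵥ v) := by
  rw [mul_vecMulVec, trace_vecMulVec, dotProduct_comm]

/-- Completing the square in the location parameter. -/
theorem sum_vecMulVec_sub_add {m n : ℕ} {ν ρ2 : ℝ} (hr : 0 < ρ2 * ν)
    (S0 : Matrix (Fin m) (Fin m) ℝ) (x : Fin n → Fin m → ℝ) (d : Fin m → ℝ) :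
    ∑ i, vecMulVec (x i - d) (x i - d) + ν • (S0 + ρ2 • vecMulVec d d) =
      scatter n (ρ2 * ν) (ν • S0) x + (n + ρ2 * ν) •
        vecMulVec (d - (n + ρ2 * ν)⁻¹ • ∑ i, x i) (d - (n + ρ2 * ν)⁻¹ • ∑ i, x i) := by
  have hq : (n : ℝ) + ρ2 * ν ≠ 0 := by positivity
  ext a b
  have h (i : Fin n) : (x i a - d a) * (x i b - d b) =
      x i a * x i b - x i a * d b - d a * x i b + d a * d b := by ring
  simp only [scatter, Matrix.add_apply, Matrix.sub_apply, Matrix.smul_apply, vecMulVec_apply,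
    Matrix.sum_apply, Pi.sub_apply, Pi.smul_apply, smul_eq_mul, Finset.sum_apply, h,
    Finset.sum_add_distrib, Finset.sum_sub_distrib, ← Finset.sum_mul, ← Finset.mul_sum,
    Finset.sum_const, Finset.card_univ, Fintype.card_fin, nsmul_eq_mul]
  generalize hq' : (n : ℝ) + ρ2 * ν = q at hq ⊢
  have hqi : q * q⁻¹ = 1 := mul_inv_cancel₀ hq
  linear_combination (d a * d b) * hq' + ((∑ i, x i a) * d b + (∑ i, x i b) * d a -
    (∑ i, x i a) * (∑ i, x i b) * q⁻¹) * hqi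

theorem mvnLik_mul_luck2 {m n : ℕ} {ν ρ2 : ℝ} (hr : 0 < ρ2 * ν) (μ0 : Fin m → ℝ)
    (S0 : Matrix (Fin m) (Fin m) ℝ) (x : Fin n → Fin m → ℝ) (μ : Fin m → ℝ)
    {S : Matrix (Fin m) (Fin m) ℝ} (hS : S.PosDef) :
    let w := μ - μ0 - (n + ρ2 * ν)⁻¹ • ∑ i, (x i - μ0)
    mvnLik m n x μ S * luck2 m μ S ν μ0 S0 ρ2 =
      (2 * π) ^ (-(m * (n + ν) / 2)) * (S.det ^ (-((n + ν) / 2)) *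
        exp (-(1 / 2) * (S⁻¹ * scatter n (ρ2 * ν) (ν • S0) (x - fun _ => μ0)).trace)) *
        exp (-((n + ρ2 * ν) / 2) * (w ⬝ᵥ (S⁻¹ *ᵥ w))) := by
  intro w
  have hd := hS.det_pos
  have key := congrArg (fun M => (S⁻¹ * M).trace)
    (sum_vecMulVec_sub_add hr S0 (x - fun _ => μ0) (μ - μ0))
  simp only [Pi.sub_apply, sub_sub_sub_cancel_right] at key
  rw [Matrix.mul_add, Matrix.mul_add, Matrix.mul_sum, trace_add, trace_add, trace_sum,
    Matrix.mul_smul, Matrix.mul_smul, trace_smul, trace_smul, trace_mul_vecMulVec] at key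
  simp only [trace_mul_vecMulVec, smul_eq_mul] at key
  unfold mvnLik luck2
  rw [Finset.prod_mul_distrib, Finset.prod_const, Finset.card_univ, Fintype.card_fin, ← exp_sum,
    ← Finset.mul_sum, mul_pow, ← rpow_mul_natCast (by positivity), ← rpow_mul_natCast hd.le,
    show -(m * (n + ν) / 2) = -(m : ℝ) / 2 * n + -(m : ℝ) * ν / 2 by ring,
    rpow_add (by positivity),
    show -((n + ν) / 2) = -(1 : ℝ) / 2 * n + -ν / 2 by ring, rpow_add hd]
  have e : exp (-(1 / 2) * ∑ i, (x i - μ) ⬝ᵥ (S⁻¹ *ᵥ (x i - μ))) *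
      exp (-(ν / 2) * (S⁻¹ * (S0 + ρ2 • vecMulVec (μ - μ0) (μ - μ0))).trace) =
      exp (-(1 / 2) * (S⁻¹ * scatter n (ρ2 * ν) (ν • S0) (x - fun _ => μ0)).trace) *
        exp (-((n + ρ2 * ν) / 2) * (w ⬝ᵥ (S⁻¹ *ᵥ w))) := by
    rw [← exp_add, ← exp_add]
    congr 1
    linarith
  linear_combination ((2 * π) ^ (-(m : ℝ) / 2 * n) * (2 * π) ^ (-(m : ℝ) * ν / 2) *
    S.det ^ (-(1 : ℝ) / 2 * n) * S.det ^ (-ν / 2)) * e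

theorem det_rpow_mul_exp_trace_le {m : ℕ} {k : ℝ} (hk : 0 < k)
    {S A : Matrix (Fin m) (Fin m) ℝ} (hS : S.PosDef) (hA : A.PosDef) :
    S.det ^ (-(k / 2)) * exp (-(1 / 2) * (S⁻¹ * A).trace) ≤
      k ^ (m * k / 2) * exp (-(m * k / 2)) * A.det ^ (-(k / 2)) := by
  have hs := hS.det_pos
  have ha := hA.det_pos
  have h := hS.det_inv_mul_le_exp_trace_sub (hA.smul (inv_pos.2 hk))
  rw [det_smul, Fintype.card_fin, Matrix.mul_smul, trace_smul, smul_eq_mul,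
    ← log_le_iff_le_exp (by positivity), log_mul (by positivity) (by positivity),
    log_mul (by positivity) (by positivity), log_pow, log_inv, log_inv] at h
  rw [rpow_def_of_pos hs, rpow_def_of_pos hk, rpow_def_of_pos ha, ← exp_add, ← exp_add,
    ← exp_add, exp_le_exp]
  have h2 := mul_le_mul_of_nonneg_left h (half_pos hk).le
  have h3 : k / 2 * (k⁻¹ * (S⁻¹ * A).trace - m) = (S⁻¹ * A).trace / 2 - m * k / 2 := by
    field_simp
  rw [h3] at h2
  linarith

theorem det_rpow_mul_exp_trace_eq {m : ℕ} {k : ℝ} (hk : 0 < k)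
    {A : Matrix (Fin m) (Fin m) ℝ} (hA : A.PosDef) :
    (k⁻¹ • A).det ^ (-(k / 2)) * exp (-(1 / 2) * ((k⁻¹ • A)⁻¹ * A).trace) =
      k ^ (m * k / 2) * exp (-(m * k / 2)) * A.det ^ (-(k / 2)) := by
  have ha := hA.det_pos
  have hinv : (k⁻¹ • A)⁻¹ * A = k • (1 : Matrix (Fin m) (Fin m) ℝ) := by
    have h : A⁻¹ * A = 1 := nonsing_inv_mul A ha.ne'.isUnit
    rw [inv_eq_left_inv (B := k • A⁻¹) (by simp [h, smul_smul, hk.ne']), smul_mul, h]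
  rw [hinv, trace_smul, trace_one, Fintype.card_fin, det_smul, Fintype.card_fin,
    mul_rpow (by positivity) ha.le, ← rpow_natCast, ← rpow_mul (by positivity),
    inv_rpow hk.le, ← rpow_neg hk.le, smul_eq_mul,
    show -((m : ℝ) * -(k / 2)) = m * k / 2 by ring,
    show -(1 / 2) * (k * m) = -(m * k / 2) by ring]
  ring

theorem supLik2_eq {m n : ℕ} {ν ρ2 : ℝ} (hν : 0 < ν) (hρ : 0 < ρ2) (μ0 : Fin m → ℝ)
    {S0 : Matrix (Fin m) (Fin m) ℝ} (hS0 : S0.PosDef) (x : Fin n → Fin m → ℝ) :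
    supLik2 m n ν μ0 S0 ρ2 x = (2 * π) ^ (-(m * (n + ν) / 2)) *
      ((n + ν) ^ (m * (n + ν) / 2) * exp (-(m * (n + ν) / 2)) *
        (scatter n (ρ2 * ν) (ν • S0) (x - fun _ => μ0)).det ^ (-((n + ν) / 2))) := by
  have hr : 0 < ρ2 * ν := by positivity
  have hk : 0 < (n : ℝ) + ν := by positivity
  have hA := scatter_posDef (n := n) hr (hS0.smul hν) (x - fun _ => μ0)
  have : Nonempty ((Fin m → ℝ) × {S : Matrix (Fin m) (Fin m) ℝ // S.PosDef}) :=
    ⟨(0, ⟨S0, hS0⟩)⟩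
  refine IsLUB.ciSup_eq (IsGreatest.isLUB ⟨?_, ?_⟩)
  · refine ⟨(μ0 + (n + ρ2 * ν)⁻¹ • ∑ i, (x i - μ0), ⟨_, hA.smul (inv_pos.2 hk)⟩), ?_⟩
    dsimp only
    rw [mvnLik_mul_luck2 hr μ0 S0 x _ (hA.smul (inv_pos.2 hk)), det_rpow_mul_exp_trace_eq hk hA]
    simp
  · rintro _ ⟨⟨μ, S, hS⟩, rfl⟩
    dsimp only
    rw [mvnLik_mul_luck2 hr μ0 S0 x _ hS]
    refine (mul_le_of_le_one_right ?_ ?_).trans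
      (mul_le_mul_of_nonneg_left (det_rpow_mul_exp_trace_le hk hS hA) (by positivity))
    · have := hS.det_pos
      positivity
    · rw [exp_le_one_iff]
      refine mul_nonpos_of_nonpos_of_nonneg (by linarith) ?_
      exact hS.inv.posSemidef.dotProduct_mulVec_nonneg _

theorem capC_rpow_det {m n : ℕ} (hm : 1 ≤ m) {ν ρ2 d : ℝ} (hν : 0 < ν) (hρ : 0 < ρ2)
    (hd : 0 < d) :
    capC m n ν (d ^ ((1 : ℝ) / m)) ρ2 = (2 * π) ^ (-(m * (n + ν) / 2)) *
      ((n + ν) ^ (m * (n + ν) / 2) * exp (-(m * (n + ν) / 2)) *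
        (((n + ρ2 * ν) / (ρ2 * ν)) ^ ((m : ℝ) / 2) * π ^ ((n : ℝ) * m / 2) *
        (multiGamma m (ν / 2) / multiGamma m ((n + ν) / 2)) * (ν ^ m * d) ^ (-(ν / 2)))) := by
  have hm0 : (0 : ℝ) < m := by exact_mod_cast hm
  have hk : 0 < (n : ℝ) + ν := by positivity
  have h1 : 1 + n / (ρ2 * ν) = (n + ρ2 * ν) / (ρ2 * ν) := by
    field_simp
    ring
  have hq : 0 < (n + ρ2 * ν) / (ρ2 * ν) := by positivity
  unfold capC
  rw [h1]
  generalize multiGamma m (ν / 2) / multiGamma m ((n + ν) / 2) = G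
  generalize (n + ρ2 * ν) / (ρ2 * ν) = q at hq
  rw [show (n : ℝ) * m / 2 = (n + ν - ν) * m / 2 by ring]
  generalize (n : ℝ) + ν = k at hk ⊢
  have h3 : (d ^ ((1 : ℝ) / m)) ^ (-(m : ℝ) * ν / 2) = d ^ (-(ν / 2)) := by
    rw [← rpow_mul hd.le]
    congr 1
    field_simp
  have h4 : (k ^ k) ^ ((m : ℝ) / 2) / ((2 * exp 1) ^ k * (π * ν) ^ ν) ^ ((m : ℝ) / 2) =
      (2 * π) ^ (-(m * k / 2)) * k ^ (m * k / 2) * exp (-(m * k / 2)) *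
        π ^ ((k - ν) * m / 2) * (ν ^ m) ^ (-(ν / 2)) := by
    simp only [rpow_def_of_pos hk, rpow_def_of_pos pi_pos, rpow_def_of_pos (pow_pos hν m),
      rpow_def_of_pos (mul_pos two_pos pi_pos), rpow_def_of_pos (mul_pos two_pos (exp_pos 1)),
      rpow_def_of_pos (mul_pos pi_pos hν), ← exp_add, rpow_def_of_pos (exp_pos _), log_exp,
      ← exp_sub, log_mul two_pos.ne' pi_pos.ne', log_mul two_pos.ne' (exp_pos 1).ne',
      log_mul pi_pos.ne' hν.ne', log_pow]
    congr 1
    ring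
  rw [h3, div_rpow (by positivity) (by positivity), mul_rpow (by positivity) hq.le,
    mul_rpow (by positivity) hd.le]
  linear_combination (d ^ (-(ν / 2)) * q ^ ((m : ℝ) / 2) * G) * h4

theorem lnml_capacity_generalized (m n : ℕ) (hm : 1 ≤ m) (hn : 1 ≤ n) (ν ρ2 : ℝ)
    (hν : (m : ℝ) - 1 < ν) (hρ : 0 < ρ2)
    (μ0 : Fin m → ℝ) (S0 : Matrix (Fin m) (Fin m) ℝ) (hS0 : S0.PosDef) :
    ∫ x : Fin n → Fin m → ℝ, supLik2 m n ν μ0 S0 ρ2 x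
      = capC m n ν (S0.det ^ ((1 : ℝ) / m)) ρ2 := by
  have hm1 : (1 : ℝ) ≤ m := by exact_mod_cast hm
  have hν0 : 0 < ν := by linarith
  have hr : 0 < ρ2 * ν := by positivity
  have hM := hS0.smul hν0
  have hG1 : 0 < multiGamma m (ν / 2) := multiGamma_pos (by linarith)
  have hG2 : 0 < multiGamma m ((n + ν) / 2) :=
    multiGamma_pos (by linarith [(n.cast_nonneg : (0 : ℝ) ≤ n)])
  have hdet := hM.det_pos
  simp only [supLik2_eq hν0 hρ μ0 hS0]
  rw [integral_const_mul, integral_const_mul,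
    integral_sub_right_eq_self (fun x : Fin n → Fin m → ℝ =>
      (scatter n (ρ2 * ν) (ν • S0) x).det ^ (-((n + ν) / 2))),
    integral_eq_lintegral_of_nonneg_ae, lintegral_det_scatter n hr hν hM,
    ENNReal.toReal_ofReal (by positivity), capC_rpow_det hm hν0 hρ hS0.det_pos, det_smul,
    Fintype.card_fin]
  · exact Filter.Eventually.of_forall fun x => rpow_nonneg (scatter_posDef hr hM x).det_pos.le _
  · exact ((continuous_scatter n _ _).matrix_det.measurable.pow_const _).aestronglyMeasurable
end
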